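/- arXiv:2202.10370 — 3 statements merged into one kernel-verified Lean document; each statement's English description precedes it below -/
import Mathlib

section
/- There are uncountably many completely multiplicative functions f : 𝓜 → {−1,+1} such that the long sum discrepancy 𝒟_f is finite. -/
open Polynomial Complex Filter
open scoped ENNReal ComplexConjugate

noncomputable section

namespace FFEDP

variable {F : Type} [Field F] [Fintype F] [DecidableEq F]

/-- `f : 𝓜 → ℂ` is completely multiplicative (on monic polynomials). -/
def CompMultOnMonic (f : F[X] → ℂ) : Prop :=
  f 1 = 1 ∧ ∀ G H : F[X], G.Monic → H.Monic → f (G * H) = f G * f H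

/-- `f` takes values in `S¹` on monic polynomials. -/
def UnimodularOnMonic (f : F[X] → ℂ) : Prop :=
  ∀ G : F[X], G.Monic → ‖f G‖ = 1

/-- A Dirichlet character modulo `Q`. -/
structure IsDirichletCharacter (Q : F[X]) (χ : F[X] → ℂ) : Prop where
  map_mul : ∀ A B : F[X], χ (A * B) = χ A * χ B
  exists_ne_zero : ∃ M : F[X], χ M ≠ 0
  periodic : ∀ M : F[X], χ (M + Q) = χ M
  eq_zero_of_not_coprime : ∀ M : F[X], ¬ IsCoprime M Q → χ M = 0

/-- A primitive Dirichlet character modulo `Q`: not induced by a character of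
smaller modulus. -/
def IsPrimitiveDirichletCharacter (Q : F[X]) (χ : F[X] → ℂ) : Prop :=
  IsDirichletCharacter Q χ ∧
    ¬ ∃ (Q' : F[X]) (χ' : F[X] → ℂ), Q' ∣ Q ∧ Q'.natDegree < Q.natDegree ∧
        IsDirichletCharacter Q' χ' ∧ ∀ M : F[X], IsCoprime M Q → χ M = χ' M

def IsPrincipalDirichletCharacter (Q : F[X]) (χ : F[X] → ℂ) : Prop :=
  IsDirichletCharacter Q χ ∧ ∀ M : F[X], IsCoprime M Q → χ M = 1

/-- the `i`-th highest-degree coefficient of `A` (zero if `i` exceeds the degree). -/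
def topCoeff (A : F[X]) (i : ℕ) : F :=
  if i ≤ A.natDegree then A.coeff (A.natDegree - i) else 0

/-- A short interval character whose value depends only on the `ν + 1`
highest-degree coefficients (so its length is at most `ν`). -/
def IsShortIntervalCharacterOfLength (ν : ℕ) (ξ : F[X] → ℂ) : Prop :=
  (∀ A B : F[X], A.Monic → B.Monic → ξ (A * B) = ξ A * ξ B) ∧
    (∃ A : F[X], A.Monic ∧ ξ A ≠ 0) ∧
    ∀ A B : F[X], A.Monic → B.Monic →
      (∀ i : ℕ, i ≤ ν → topCoeff A i = topCoeff B i) → ξ A = ξ B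

def IsShortIntervalCharacter (ξ : F[X] → ℂ) : Prop :=
  ∃ ν : ℕ, IsShortIntervalCharacterOfLength ν ξ

/-- the Archimedean character `e_θ(G) = e(θ · deg G)`. -/
def eTheta (θ : ℝ) (G : F[X]) : ℂ :=
  Complex.exp (2 * (Real.pi : ℂ) * Complex.I * (θ : ℂ) * (G.natDegree : ℂ))

/-- `∑_{G ∈ 𝓜, deg G ≤ N} f(G)`. -/
def longSum (f : F[X] → ℂ) (N : ℕ) : ℂ :=
  ∑ᶠ G ∈ {G : F[X] | G.Monic ∧ G.natDegree ≤ N}, f G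

/-- `∑_{G ∈ 𝓜, deg G < H} f(G)`. -/
def longSumLt (f : F[X] → ℂ) (H : ℕ) : ℂ :=
  ∑ᶠ G ∈ {G : F[X] | G.Monic ∧ G.natDegree < H}, f G

/-- `∑_{G ∈ I_H(G₀)} f(G)` where `I_H(G₀) = {G ∈ 𝓜 : deg (G - G₀) < H}`. -/
def shortIntervalSum (f : F[X] → ℂ) (H : ℕ) (G₀ : F[X]) : ℂ :=
  ∑ᶠ G ∈ {G : F[X] | G.Monic ∧ (G - G₀).degree < (H : WithBot ℕ)}, f G

/-- the short sum discrepancy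
`𝒮_f = limsup_{H → ∞} limsup_{N → ∞} max_{G₀ ∈ 𝓜_N} |∑_{G ∈ I_H(G₀)} f(G)|`,
as an extended nonnegative real. -/
def shortSumDisc (f : F[X] → ℂ) : ℝ≥0∞ :=
  Filter.limsup (fun H : ℕ =>
    Filter.limsup (fun N : ℕ =>
      ⨆ G₀ ∈ {G₀ : F[X] | G₀.Monic ∧ G₀.natDegree = N},
        (‖shortIntervalSum f H G₀‖₊ : ℝ≥0∞)) Filter.atTop) Filter.atTop

/-- the pretentious distance `𝔻(f, g; N)`. -/
def pretDist (f g : F[X] → ℂ) (N : ℕ) : ℝ :=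
  Real.sqrt (∑ᶠ P ∈ {P : F[X] | P.Monic ∧ Irreducible P ∧ P.natDegree ≤ N},
    ((Fintype.card F : ℝ) ^ P.natDegree)⁻¹ * (1 - (f P * conj (g P)).re))

/-- `ω(Q)`: the number of distinct monic irreducible divisors of `Q`. -/
def omegaPoly (Q : F[X]) : ℕ :=
  Set.ncard {P : F[X] | P.Monic ∧ Irreducible P ∧ P ∣ Q}

/-- `f` is a modified character associated with the character `χ` of modulus `Q`:
it is completely multiplicative, takes values in `S¹` on monics, and agrees with
`χ` at every monic irreducible not dividing `Q`. -/
def IsModifiedCharacter (Q : F[X]) (χ f : F[X] → ℂ) : Prop :=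
  CompMultOnMonic f ∧ UnimodularOnMonic f ∧ IsDirichletCharacter Q χ ∧
    ∀ P : F[X], P.Monic → Irreducible P → ¬ P ∣ Q → f P = χ P

set_option linter.unusedSectionVars false

section Relabel

open UniqueFactorizationMonoid

/-- The multiplicative map on monic polynomials that replaces each monic irreducible factor `P`
by `σ P`. -/
def relabel (σ : F[X] → F[X]) (G : F[X]) : F[X] :=
  ((normalizedFactors G).map σ).prod

theorem monic_of_mem_normalizedFactors {G P : F[X]} (hP : P ∈ normalizedFactors G) : P.Monic := by
  rw [← normalize_normalized_factor P hP]
  exact monic_normalize (irreducible_of_normalized_factor P hP).ne_zero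

theorem prod_normalizedFactors_of_monic {G : F[X]} (hG : G.Monic) :
    (normalizedFactors G).prod = G := by
  refine eq_of_monic_of_associated ?_ hG (prod_normalizedFactors hG.ne_zero)
  simpa using monic_multiset_prod_of_monic (normalizedFactors G) id
    fun P hP => monic_of_mem_normalizedFactors hP

theorem relabel_one (σ : F[X] → F[X]) : relabel σ 1 = 1 := by
  simp [relabel]

theorem relabel_mul (σ : F[X] → F[X]) {G H : F[X]} (hG : G ≠ 0) (hH : H ≠ 0) :
    relabel σ (G * H) = relabel σ G * relabel σ H := by
  simp [relabel, normalizedFactors_mul hG hH]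

theorem relabel_of_irreducible (σ : F[X] → F[X]) {P : F[X]} (hP : P.Monic) (hP' : Irreducible P) :
    relabel σ P = σ P := by
  simp [relabel, normalizedFactors_irreducible hP', hP.normalize_eq_self]

/-- `σ` sends monic irreducible polynomials to monic irreducible polynomials of the same degree. -/
def PreservesPrimes (σ : F[X] → F[X]) : Prop :=
  ∀ P : F[X], P.Monic → Irreducible P →
    (σ P).Monic ∧ Irreducible (σ P) ∧ (σ P).natDegree = P.natDegree

variable {σ : F[X] → F[X]}

theorem monic_relabel (hσ : PreservesPrimes σ) (G : F[X]) :
    (relabel σ G).Monic :=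
  monic_multiset_prod_of_monic _ _ fun P hP =>
    (hσ P (monic_of_mem_normalizedFactors hP) (irreducible_of_normalized_factor P hP)).1

theorem natDegree_relabel (hσ : PreservesPrimes σ) {G : F[X]} (hG : G.Monic) :
    (relabel σ G).natDegree = G.natDegree := by
  have key : ∀ P ∈ normalizedFactors G,
      (σ P).Monic ∧ Irreducible (σ P) ∧ (σ P).natDegree = P.natDegree := fun P hP =>
    hσ P (monic_of_mem_normalizedFactors hP) (irreducible_of_normalized_factor P hP)
  conv_rhs => rw [← prod_normalizedFactors_of_monic hG]
  rw [relabel, natDegree_multiset_prod_of_monic, natDegree_multiset_prod_of_monic,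
    Multiset.map_map]
  · exact congrArg _ (Multiset.map_congr rfl fun P hP => (key P hP).2.2)
  · exact fun P hP => monic_of_mem_normalizedFactors hP
  · intro Q hQ
    obtain ⟨P, hP, rfl⟩ := Multiset.mem_map.1 hQ
    exact (key P hP).1

theorem relabel_relabel (hσ : PreservesPrimes σ)
    (hinv : Function.Involutive σ) {G : F[X]} (hG : G.Monic) :
    relabel σ (relabel σ G) = G := by
  have key : ∀ P ∈ normalizedFactors G,
      (σ P).Monic ∧ Irreducible (σ P) ∧ (σ P).natDegree = P.natDegree := fun P hP =>
    hσ P (monic_of_mem_normalizedFactors hP) (irreducible_of_normalized_factor P hP)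
  have hfac : normalizedFactors (relabel σ G) = (normalizedFactors G).map σ := by
    rw [relabel, normalizedFactors_prod_eq, Multiset.map_map]
    · exact Multiset.map_congr rfl fun P hP => (key P hP).1.normalize_eq_self
    · intro Q hQ
      obtain ⟨P, hP, rfl⟩ := Multiset.mem_map.1 hQ
      exact (key P hP).2.1
  conv_lhs => rw [relabel, hfac, Multiset.map_map, hinv.comp_self, Multiset.map_id]
  exact prod_normalizedFactors_of_monic hG

/-- Relabelling the primes by a degree-preserving involution does not change long sums. -/
theorem longSum_relabel (hσ : PreservesPrimes σ)
    (hinv : Function.Involutive σ) (f : F[X] → ℂ) (N : ℕ) :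
    longSum (fun G => if G.Monic then f (relabel σ G) else 0) N = longSum f N := by
  have maps : Set.MapsTo (relabel σ) {G : F[X] | G.Monic ∧ G.natDegree ≤ N}
      {G : F[X] | G.Monic ∧ G.natDegree ≤ N} := fun G hG =>
    ⟨monic_relabel hσ G, (natDegree_relabel hσ hG.1).trans_le hG.2⟩
  refine finsum_mem_eq_of_bijOn (relabel σ) (Set.InvOn.bijOn (f' := relabel σ)
    ⟨fun G hG => relabel_relabel hσ hinv hG.1, fun G hG => relabel_relabel hσ hinv hG.1⟩
    maps maps) fun G hG => if_pos hG.1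

end Relabel

/-- On polynomials whose degree lies in `A`, exchange the two polynomials that `P` and `P'`
assign to that degree. -/
def swapInDegrees (P P' : ℕ → F[X]) (A : Set ℕ) (G : F[X]) : F[X] :=
  open Classical in
  if G.natDegree ∈ A then Equiv.swap (P G.natDegree) (P' G.natDegree) G else G

theorem preservesPrimes_swapInDegrees {P P' : ℕ → F[X]} {A : Set ℕ}
    (hP : ∀ d ∈ A, (P d).Monic ∧ Irreducible (P d) ∧ (P d).natDegree = d)
    (hP' : ∀ d ∈ A, (P' d).Monic ∧ Irreducible (P' d) ∧ (P' d).natDegree = d) :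
    PreservesPrimes (swapInDegrees P P' A) := by
  intro G hG hG'
  unfold swapInDegrees
  split_ifs with h
  · rw [Equiv.swap_apply_def]
    split_ifs
    exacts [hP' _ h, hP _ h, ⟨hG, hG', rfl⟩]
  · exact ⟨hG, hG', rfl⟩

theorem swapInDegrees_involutive {P P' : ℕ → F[X]} {A : Set ℕ}
    (hP : ∀ d ∈ A, (P d).natDegree = d) (hP' : ∀ d ∈ A, (P' d).natDegree = d) :
    Function.Involutive (swapInDegrees P P' A) := by
  intro G
  by_cases h : G.natDegree ∈ A
  · have hval : swapInDegrees P P' A G = Equiv.swap (P G.natDegree) (P' G.natDegree) G :=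
      if_pos h
    have hdeg : (swapInDegrees P P' A G).natDegree = G.natDegree := by
      rw [hval, Equiv.swap_apply_def]
      split_ifs
      exacts [hP' _ h, hP _ h, rfl]
    rw [swapInDegrees, hdeg, if_pos h, hval, Equiv.swap_apply_self]
  · have hval : swapInDegrees P P' A G = G := if_neg h
    rw [hval, hval]

/-- A bounded-discrepancy sign function that takes both signs on the monic irreducibles of each odd
degree yields uncountably many such functions. -/
theorem not_countable_of_both_signs {f : F[X] → ℂ} (hmul : CompMultOnMonic f)
    (hsign : ∀ G : F[X], G.Monic → f G = 1 ∨ f G = -1)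
    (hbdd : ∃ C : ℝ, ∀ N : ℕ, 1 ≤ N → ‖longSum f N‖ ≤ C)
    (hpair : ∀ d : ℕ, Odd d → 1 < d → ∃ P P' : F[X],
      (P.Monic ∧ Irreducible P ∧ P.natDegree = d) ∧
      (P'.Monic ∧ Irreducible P' ∧ P'.natDegree = d) ∧ f P' = -f P) :
    ¬ Set.Countable {f : F[X] → ℂ |
        CompMultOnMonic f ∧
        (∀ G : F[X], G.Monic → f G = 1 ∨ f G = -1) ∧
        (∀ G : F[X], ¬ G.Monic → f G = 0) ∧
        ∃ C : ℝ, ∀ N : ℕ, 1 ≤ N → ‖longSum f N‖ ≤ C} := by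
  classical
  intro hcount
  choose! P P' hP hP' hPP' using hpair
  let e : ℕ → ℕ := fun k => 2 * k + 3
  have he : Function.Injective e := fun a b h => by simpa [e] using h
  have odd_e : ∀ k, Odd (e k) := fun k => ⟨k + 1, by simp only [e]; ring⟩
  have one_lt_e : ∀ k, 1 < e k := fun k => by simp only [e]; omega
  have hA : ∀ (A : Set ℕ), ∀ d ∈ Set.image e A, Odd d ∧ 1 < d := by
    rintro A _ ⟨k, -, rfl⟩
    exact ⟨odd_e k, one_lt_e k⟩
  let σ : Set ℕ → F[X] → F[X] := fun A => swapInDegrees P P' (Set.image e A)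
  have hσ : ∀ A, PreservesPrimes (σ A) := fun A =>
    preservesPrimes_swapInDegrees (fun d hd => hP d (hA A d hd).1 (hA A d hd).2)
      (fun d hd => hP' d (hA A d hd).1 (hA A d hd).2)
  have hinv : ∀ A, Function.Involutive (σ A) := fun A =>
    swapInDegrees_involutive (fun d hd => (hP d (hA A d hd).1 (hA A d hd).2).2.2)
      (fun d hd => (hP' d (hA A d hd).1 (hA A d hd).2).2.2)
  let g : Set ℕ → F[X] → ℂ := fun A G => if G.Monic then f (relabel (σ A) G) else 0
  have hg : ∀ A, g A ∈ {f : F[X] → ℂ |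
        CompMultOnMonic f ∧
        (∀ G : F[X], G.Monic → f G = 1 ∨ f G = -1) ∧
        (∀ G : F[X], ¬ G.Monic → f G = 0) ∧
        ∃ C : ℝ, ∀ N : ℕ, 1 ≤ N → ‖longSum f N‖ ≤ C} := by
    intro A
    refine ⟨⟨?_, fun G H hG hH => ?_⟩, fun G hG => ?_, fun G hG => if_neg hG, ?_⟩
    · simp [g, relabel_one, hmul.1]
    · simp only [g, if_pos hG, if_pos hH, if_pos (hG.mul hH),
        relabel_mul (σ A) hG.ne_zero hH.ne_zero]
      exact hmul.2 _ _ (monic_relabel (hσ A) G) (monic_relabel (hσ A) H)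
    · simp only [g, if_pos hG]
      exact hsign _ (monic_relabel (hσ A) G)
    · obtain ⟨C, hC⟩ := hbdd
      refine ⟨C, fun N hN => ?_⟩
      rw [longSum_relabel (hσ A) (hinv A)]
      exact hC N hN
  have hval : ∀ A k, g A (P (e k)) = if k ∈ A then -f (P (e k)) else f (P (e k)) := by
    intro A k
    obtain ⟨hm, hi, hd⟩ := hP (e k) (odd_e k) (one_lt_e k)
    simp only [g, if_pos hm, relabel_of_irreducible (σ A) hm hi, σ, swapInDegrees, hd,
      he.mem_set_image]
    split_ifs
    · rw [Equiv.swap_apply_left, hPP' (e k) (odd_e k) (one_lt_e k)]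
    · rfl
  have hginj : Function.Injective g := by
    intro A B hAB
    ext k
    have hk := congrFun hAB (P (e k))
    have hne : -f (P (e k)) ≠ f (P (e k)) := by
      rcases hsign _ (hP (e k) (odd_e k) (one_lt_e k)).1 with h | h <;> rw [h] <;> norm_num
    rw [hval, hval] at hk
    by_cases h1 : k ∈ A <;> by_cases h2 : k ∈ B <;> simp only [h1, h2, if_true, if_false] at hk ⊢
    · exact (hne hk).elim
    · exact (hne hk.symm).elim
  have : Countable (Set ℕ) := by
    have := hcount.to_subtype
    exact Function.Injective.countable (f := fun A => (⟨g A, hg A⟩ : {f : F[X] → ℂ |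
        CompMultOnMonic f ∧
        (∀ G : F[X], G.Monic → f G = 1 ∨ f G = -1) ∧
        (∀ G : F[X], ¬ G.Monic → f G = 0) ∧
        ∃ C : ℝ, ∀ N : ℕ, 1 ≤ N → ‖longSum f N‖ ≤ C}))
      fun A B h => hginj (congrArg Subtype.val h)
  obtain ⟨φ, hφ⟩ := exists_injective_nat (Set ℕ)
  exact Function.cantor_injective φ hφ

theorem exists_monic_irreducible_natDegree {d : ℕ} (hd : d ≠ 0) :
    ∃ P : F[X], P.Monic ∧ Irreducible P ∧ P.natDegree = d := by
  have : NeZero d := ⟨hd⟩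
  let p := ringChar F
  have : CharP F p := ringChar.charP F
  have : Fact p.Prime := ⟨CharP.char_is_prime F p⟩
  obtain ⟨α, hα⟩ := Field.exists_primitive_element F (FiniteField.Extension F p d)
  have hint : IsIntegral F α := IsIntegral.of_finite F α
  refine ⟨minpoly F α, minpoly.monic hint, minpoly.irreducible hint, ?_⟩
  rw [(Field.primitive_element_iff_minpoly_natDegree_eq F α).1 hα, FiniteField.finrank_extension]

theorem finite_monic_natDegree_le (N : ℕ) : {G : F[X] | G.Monic ∧ G.natDegree ≤ N}.Finite := by
  have : Finite (degreeLT F (N + 1)) := Finite.of_equiv _ (degreeLTEquiv F (N + 1)).toEquiv.symm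
  refine Set.Finite.subset (Set.toFinite (degreeLT F (N + 1) : Set F[X])) fun G hG => ?_
  exact mem_degreeLT.2 (degree_lt_iff_coeff_zero _ _ |>.2 fun m hm =>
    coeff_eq_zero_of_natDegree_lt (by have := hG.2; omega))

/-- If a bijection of the monic polynomials of degree at most `N` lying outside `B` flips the sign
of `f`, then only `B` contributes to the long sum. -/
theorem longSum_eq_sum_of_sign_flip {f : F[X] → ℂ} {N : ℕ} (B : Finset F[X])
    (hB : ∀ G ∈ B, G.Monic ∧ G.natDegree ≤ N) (φ : F[X] → F[X])
    (hφ : Set.BijOn φ ({G : F[X] | G.Monic ∧ G.natDegree ≤ N} \ B)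
      ({G : F[X] | G.Monic ∧ G.natDegree ≤ N} \ B))
    (hflip : ∀ G ∈ {G : F[X] | G.Monic ∧ G.natDegree ≤ N} \ B, f (φ G) = -f G) :
    longSum f N = ∑ G ∈ B, f G := by
  have hfin := finite_monic_natDegree_le (F := F) N
  have hzero : ∑ᶠ G ∈ {G : F[X] | G.Monic ∧ G.natDegree ≤ N} \ B, f G = 0 := by
    have h := finsum_mem_eq_of_bijOn (f := fun G => -f G) (g := f) φ hφ
      fun G hG => (hflip G hG).symm
    rw [finsum_mem_neg_distrib _ hfin.sdiff] at h
    exact self_eq_neg.1 h.symm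
  have hsub : (B : Set F[X]) ⊆ {G : F[X] | G.Monic ∧ G.natDegree ≤ N} := hB
  rw [longSum, ← finsum_mem_add_sdiff hsub hfin, hzero, add_zero, finsum_mem_coe_finset]

section OddCharacteristic

/-- The quadratic character modulo `X`, modified to take the value `-1` at `X`. -/
def modifiedQuadraticChar (G : F[X]) : ℂ :=
  (-1) ^ G.natTrailingDegree * (quadraticChar F G.trailingCoeff : ℂ)

theorem modifiedQuadraticChar_mul {G H : F[X]} (hG : G ≠ 0) (hH : H ≠ 0) :
    modifiedQuadraticChar (G * H) = modifiedQuadraticChar G * modifiedQuadraticChar H := by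
  simp only [modifiedQuadraticChar, trailingCoeff_mul, natTrailingDegree_mul hG hH, map_mul,
    pow_add, Int.cast_mul]
  ring

theorem modifiedQuadraticChar_eq_one_or {G : F[X]} (hG : G ≠ 0) :
    modifiedQuadraticChar G = 1 ∨ modifiedQuadraticChar G = -1 := by
  unfold modifiedQuadraticChar
  rcases quadraticChar_dichotomy (trailingCoeff_nonzero_iff_nonzero.2 hG) with h | h <;>
  rcases neg_one_pow_eq_or ℂ G.natTrailingDegree with h' | h' <;> simp [h, h']

theorem modifiedQuadraticChar_X_pow (n : ℕ) :
    modifiedQuadraticChar (X ^ n : F[X]) = (-1) ^ n := by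
  simp [modifiedQuadraticChar, trailingCoeff]

/-- Multiply the trailing coefficient of `G` by `a`. -/
def scaleTrailing (a : F) (G : F[X]) : F[X] :=
  G + C ((a - 1) * G.trailingCoeff) * X ^ G.natTrailingDegree

theorem coeff_scaleTrailing (a : F) (G : F[X]) (n : ℕ) :
    (scaleTrailing a G).coeff n =
      if n = G.natTrailingDegree then a * G.trailingCoeff else G.coeff n := by
  rw [scaleTrailing, coeff_add, coeff_C_mul_X_pow]
  split_ifs with h
  · rw [h, trailingCoeff]
    ring
  · rw [add_zero]

theorem natTrailingDegree_scaleTrailing {a : F} (ha : a ≠ 0) {G : F[X]} (hG : G ≠ 0) :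
    (scaleTrailing a G).natTrailingDegree = G.natTrailingDegree := by
  have hv : (scaleTrailing a G).coeff G.natTrailingDegree ≠ 0 := by
    rw [coeff_scaleTrailing, if_pos rfl]
    exact mul_ne_zero ha (trailingCoeff_nonzero_iff_nonzero.2 hG)
  refine le_antisymm (natTrailingDegree_le_of_ne_zero hv) (le_natTrailingDegree ?_ fun m hm => ?_)
  · exact fun h => hv (by rw [h, coeff_zero])
  · rw [coeff_scaleTrailing, if_neg hm.ne, coeff_eq_zero_of_lt_natTrailingDegree hm]

theorem trailingCoeff_scaleTrailing {a : F} (ha : a ≠ 0) {G : F[X]} (hG : G ≠ 0) :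
    (scaleTrailing a G).trailingCoeff = a * G.trailingCoeff := by
  rw [trailingCoeff, natTrailingDegree_scaleTrailing ha hG, coeff_scaleTrailing, if_pos rfl]

theorem scaleTrailing_scaleTrailing {a b : F} (hab : b * a = 1) {G : F[X]} (hG : G ≠ 0) :
    scaleTrailing b (scaleTrailing a G) = G := by
  have ha : a ≠ 0 := right_ne_zero_of_mul_eq_one hab
  ext n
  rw [coeff_scaleTrailing, trailingCoeff_scaleTrailing ha hG,
    natTrailingDegree_scaleTrailing ha hG, coeff_scaleTrailing, ← mul_assoc, hab, one_mul]
  split_ifs with h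
  · rw [h, trailingCoeff]
  · rfl

theorem natDegree_scaleTrailing {a : F} {G : F[X]} (h : G.natTrailingDegree < G.natDegree) :
    (scaleTrailing a G).natDegree = G.natDegree := by
  refine natDegree_add_eq_left_of_natDegree_lt (lt_of_le_of_lt (natDegree_C_mul_X_pow_le _ _) h)

theorem monic_scaleTrailing {a : F} {G : F[X]} (hG : G.Monic)
    (h : G.natTrailingDegree < G.natDegree) : (scaleTrailing a G).Monic := by
  rw [Monic, leadingCoeff, natDegree_scaleTrailing h, coeff_scaleTrailing, if_neg h.ne']
  exact hG

theorem natTrailingDegree_lt_natDegree_iff {G : F[X]} (hG : G.Monic) :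
    G.natTrailingDegree < G.natDegree ↔ G ≠ X ^ G.natDegree := by
  constructor
  · intro h h'
    rw [h'] at h
    simp at h
  · refine fun h => lt_of_le_of_ne (natTrailingDegree_le_natDegree G) fun h' => h ?_
    ext n
    rw [coeff_X_pow]
    split_ifs with hn
    · rw [hn]
      exact hG
    · rcases lt_or_gt_of_ne hn with hlt | hgt
      · exact coeff_eq_zero_of_lt_natTrailingDegree (h' ▸ hlt)
      · exact coeff_eq_zero_of_natDegree_lt hgt

theorem longSum_modifiedQuadraticChar (hF : ringChar F ≠ 2) (N : ℕ) :
    longSum (modifiedQuadraticChar (F := F)) N = ∑ n ∈ Finset.range (N + 1), (-1 : ℂ) ^ n := by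
  obtain ⟨a, ha⟩ := quadraticChar_exists_neg_one hF
  have ha0 : a ≠ 0 := by
    rintro rfl
    simp at ha
  let B : Finset F[X] := (Finset.range (N + 1)).image (X ^ ·)
  have hmem : ∀ G : F[X], G ∈ {G : F[X] | G.Monic ∧ G.natDegree ≤ N} \ (B : Set F[X]) ↔
      (G.Monic ∧ G.natDegree ≤ N) ∧ G.natTrailingDegree < G.natDegree := by
    intro G
    rw [Set.mem_sdiff, Set.mem_ofPred_eq]
    refine and_congr_right fun hG => ?_
    rw [natTrailingDegree_lt_natDegree_iff hG.1, Finset.mem_coe, not_iff_not]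
    simp only [B, Finset.mem_image, Finset.mem_range]
    constructor
    · rintro ⟨n, -, rfl⟩
      simp
    · exact fun h => ⟨G.natDegree, by omega, h.symm⟩
  have maps : ∀ b : F, b ≠ 0 → Set.MapsTo (scaleTrailing b)
      ({G : F[X] | G.Monic ∧ G.natDegree ≤ N} \ B)
      ({G : F[X] | G.Monic ∧ G.natDegree ≤ N} \ B) := by
    intro b hb G hG
    obtain ⟨⟨hm, hd⟩, hlt⟩ := (hmem G).1 hG
    refine (hmem _).2 ⟨⟨monic_scaleTrailing hm hlt, ?_⟩, ?_⟩
    · rwa [natDegree_scaleTrailing hlt]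
    · rwa [natDegree_scaleTrailing hlt, natTrailingDegree_scaleTrailing hb hm.ne_zero]
  have hbij := Set.InvOn.bijOn (f := scaleTrailing a) (f' := scaleTrailing a⁻¹)
    ⟨fun G hG => scaleTrailing_scaleTrailing (inv_mul_cancel₀ ha0) hG.1.1.ne_zero,
      fun G hG => scaleTrailing_scaleTrailing (mul_inv_cancel₀ ha0) hG.1.1.ne_zero⟩
    (maps a ha0) (maps a⁻¹ (inv_ne_zero ha0))
  rw [longSum_eq_sum_of_sign_flip B ?_ _ hbij ?_, Finset.sum_image]
  · exact Finset.sum_congr rfl fun n _ => modifiedQuadraticChar_X_pow n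
  · intro m _ n _ h
    simpa using congrArg natDegree h
  · intro G hG
    obtain ⟨n, hn, rfl⟩ := Finset.mem_image.1 hG
    exact ⟨monic_X_pow n, by simpa [Nat.lt_succ_iff] using hn⟩
  · intro G hG
    have hG0 : G ≠ 0 := hG.1.1.ne_zero
    rw [modifiedQuadraticChar, natTrailingDegree_scaleTrailing ha0 hG0,
      trailingCoeff_scaleTrailing ha0 hG0, map_mul, ha, modifiedQuadraticChar]
    push_cast
    ring

theorem irreducible_scaleRoots {a : F} (ha : a ≠ 0) {P : F[X]} (hP : Irreducible P) :
    Irreducible (P.scaleRoots a) := by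
  let e : F[X] ≃* F[X] :=
    { toFun := fun Q => Q.scaleRoots a
      invFun := fun Q => Q.scaleRoots a⁻¹
      left_inv := fun Q => by simp [← scaleRoots_mul, ha]
      right_inv := fun Q => by simp [← scaleRoots_mul, ha]
      map_mul' := fun Q R => mul_scaleRoots_of_noZeroDivisors Q R a }
  exact (MulEquiv.irreducible_iff e).2 hP

theorem modifiedQuadraticChar_of_coeff_zero_ne {G : F[X]} (hG : G.coeff 0 ≠ 0) :
    modifiedQuadraticChar G = (quadraticChar F (G.coeff 0) : ℂ) := by
  have h : G.natTrailingDegree = 0 := natTrailingDegree_eq_zero.2 (Or.inr hG)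
  rw [modifiedQuadraticChar, trailingCoeff, h, pow_zero, one_mul]

theorem not_countable_of_odd_char (hF : ringChar F ≠ 2) :
    ¬ Set.Countable {f : F[X] → ℂ |
        CompMultOnMonic f ∧
        (∀ G : F[X], G.Monic → f G = 1 ∨ f G = -1) ∧
        (∀ G : F[X], ¬ G.Monic → f G = 0) ∧
        ∃ C : ℝ, ∀ N : ℕ, 1 ≤ N → ‖longSum f N‖ ≤ C} := by
  refine not_countable_of_both_signs (f := modifiedQuadraticChar)
    ⟨by simpa using modifiedQuadraticChar_X_pow (F := F) 0,
      fun G H hG hH => modifiedQuadraticChar_mul hG.ne_zero hH.ne_zero⟩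
    (fun G hG => modifiedQuadraticChar_eq_one_or hG.ne_zero) ⟨1, fun N _ => ?_⟩
    fun d hodd hd => ?_
  · rw [longSum_modifiedQuadraticChar hF, neg_one_geom_sum]
    split_ifs <;> simp
  · obtain ⟨a, ha⟩ := quadraticChar_exists_neg_one hF
    have ha0 : a ≠ 0 := by
      rintro rfl
      simp at ha
    obtain ⟨P, hm, hi, rfl⟩ := exists_monic_irreducible_natDegree (F := F) (d := d) (by omega)
    have h0 : P.coeff 0 ≠ 0 := by
      intro h
      have hdeg := degree_eq_one_of_irreducible_of_root hi
        (show P.IsRoot 0 by rwa [IsRoot, ← coeff_zero_eq_eval_zero])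
      exact hd.ne' (natDegree_eq_of_degree_eq_some hdeg)
    have h0' : (P.scaleRoots a).coeff 0 = P.coeff 0 * a ^ P.natDegree := by
      rw [coeff_scaleRoots, Nat.sub_zero]
    refine ⟨P, P.scaleRoots a, ⟨hm, hi, rfl⟩, ⟨(monic_scaleRoots_iff a).2 hm,
      irreducible_scaleRoots ha0 hi, natDegree_scaleRoots P a⟩, ?_⟩
    rw [modifiedQuadraticChar_of_coeff_zero_ne h0, modifiedQuadraticChar_of_coeff_zero_ne
      (h0' ▸ mul_ne_zero h0 (pow_ne_zero _ ha0)), h0', map_mul, map_pow, ha, hodd.neg_one_pow]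
    simp

end OddCharacteristic

section EvenCharacteristic

/-- Add `1` to the coefficient of `G` just below the leading one. -/
def shiftNext (G : F[X]) : F[X] :=
  G + X ^ (G.natDegree - 1)

theorem natDegree_shiftNext {G : F[X]} (h : 0 < G.natDegree) :
    (shiftNext G).natDegree = G.natDegree :=
  natDegree_add_eq_left_of_natDegree_lt (by rw [natDegree_X_pow]; omega)

theorem monic_shiftNext {G : F[X]} (hG : G.Monic) (h : 0 < G.natDegree) :
    (shiftNext G).Monic :=
  hG.add_of_left (by
    rw [degree_X_pow, degree_eq_natDegree hG.ne_zero]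
    exact_mod_cast (by omega : G.natDegree - 1 < G.natDegree))

theorem shiftNext_shiftNext [CharP F 2] {G : F[X]} (h : 0 < G.natDegree) :
    shiftNext (shiftNext G) = G := by
  rw [shiftNext, natDegree_shiftNext h, shiftNext, add_assoc, CharTwo.add_self_eq_zero, add_zero]

theorem nextCoeff_shiftNext {G : F[X]} (h : 0 < G.natDegree) :
    (shiftNext G).nextCoeff = G.nextCoeff + 1 := by
  rw [nextCoeff_of_natDegree_pos h, nextCoeff_of_natDegree_pos (by rwa [natDegree_shiftNext h]),
    natDegree_shiftNext h, shiftNext, coeff_add, coeff_X_pow, if_pos rfl]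

theorem longSum_addChar_nextCoeff [CharP F 2] {ψ : AddChar F ℂ} (hψ : ψ 1 = -1) (N : ℕ) :
    longSum (fun G : F[X] => ψ G.nextCoeff) N = 1 := by
  have hmem : ∀ G : F[X], G ∈
        {G : F[X] | G.Monic ∧ G.natDegree ≤ N} \ (({1} : Finset F[X]) : Set F[X]) ↔
      (G.Monic ∧ G.natDegree ≤ N) ∧ 0 < G.natDegree := by
    intro G
    rw [Set.mem_sdiff, Set.mem_ofPred_eq, Finset.coe_singleton, Set.mem_singleton_iff]
    refine and_congr_right fun hG => ?_
    rw [← hG.1.natDegree_eq_zero, Nat.pos_iff_ne_zero]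
  have maps : Set.MapsTo shiftNext
      ({G : F[X] | G.Monic ∧ G.natDegree ≤ N} \ (({1} : Finset F[X]) : Set F[X]))
      ({G : F[X] | G.Monic ∧ G.natDegree ≤ N} \ (({1} : Finset F[X]) : Set F[X])) := by
    intro G hG
    obtain ⟨⟨hm, hd⟩, hpos⟩ := (hmem G).1 hG
    exact (hmem _).2 ⟨⟨monic_shiftNext hm hpos, (natDegree_shiftNext hpos).trans_le hd⟩,
      (natDegree_shiftNext hpos).symm ▸ hpos⟩
  rw [longSum_eq_sum_of_sign_flip {1} ?_ shiftNext (Set.InvOn.bijOn (f' := shiftNext)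
    ⟨fun G hG => shiftNext_shiftNext ((hmem G).1 hG).2,
      fun G hG => shiftNext_shiftNext ((hmem G).1 hG).2⟩ maps maps) ?_]
  · simp [nextCoeff]
  · simp
  · intro G hG
    simp [nextCoeff_shiftNext ((hmem G).1 hG).2, AddChar.map_add_eq_mul, hψ]

theorem nextCoeff_taylor_of_monic {P : F[X]} (hP : P.Monic) (hpos : 0 < P.natDegree) (r : F) :
    (taylor r P).nextCoeff = P.nextCoeff + P.natDegree * r := by
  obtain ⟨n, hn⟩ : ∃ n, P.natDegree = n + 1 := ⟨P.natDegree - 1, by omega⟩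
  have hlead : P.coeff (n + 1) = 1 := hn ▸ hP
  have hdeg : (hasseDeriv n P).natDegree < 2 :=
    (natDegree_hasseDeriv_le P n).trans_lt (by omega)
  rw [nextCoeff_of_natDegree_pos hpos, nextCoeff_of_natDegree_pos (by rwa [natDegree_taylor]),
    natDegree_taylor, hn, Nat.add_sub_cancel, taylor_coeff, eval_eq_sum_range' hdeg,
    Finset.sum_range_succ, Finset.sum_range_one, hasseDeriv_coeff, hasseDeriv_coeff]
  simp [add_comm 1 n, hlead]

theorem not_countable_of_char_two [CharP F 2] :
    ¬ Set.Countable {f : F[X] → ℂ |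
        CompMultOnMonic f ∧
        (∀ G : F[X], G.Monic → f G = 1 ∨ f G = -1) ∧
        (∀ G : F[X], ¬ G.Monic → f G = 0) ∧
        ∃ C : ℝ, ∀ N : ℕ, 1 ≤ N → ‖longSum f N‖ ≤ C} := by
  obtain ⟨ψ, hψ⟩ := AddChar.exists_apply_ne_zero.2 (one_ne_zero (α := F))
  have hval : ∀ x, ψ x = 1 ∨ ψ x = -1 := fun x => by
    rw [← sq_eq_one_iff, sq, ← AddChar.map_add_eq_mul, CharTwo.add_self_eq_zero,
      AddChar.map_zero_eq_one]
  have hψ1 : ψ 1 = -1 := (hval 1).resolve_left hψ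
  refine not_countable_of_both_signs (f := fun G => ψ G.nextCoeff) ⟨by simp [nextCoeff],
    fun G H hG hH => ?_⟩ (fun G _ => hval _) ⟨1, fun N _ => ?_⟩ fun d hodd hd => ?_
  · simp only [hG.nextCoeff_mul hH, AddChar.map_add_eq_mul]
  · rw [longSum_addChar_nextCoeff hψ1, norm_one]
  · obtain ⟨P, hm, hi, rfl⟩ := exists_monic_irreducible_natDegree (F := F) (d := d) (by omega)
    refine ⟨P, taylor 1 P, ⟨hm, hi, rfl⟩, ⟨?_, ?_, natDegree_taylor P 1⟩, ?_⟩
    · rw [Monic, leadingCoeff_taylor]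
      exact hm
    · exact (MulEquiv.irreducible_iff (taylorEquiv (1 : F))).2 hi
    · have hcast : (P.natDegree : F) = 1 := by
        obtain ⟨k, hk⟩ := hodd
        rw [hk]
        push_cast
        rw [CharTwo.two_eq_zero, zero_mul, zero_add]
      rw [nextCoeff_taylor_of_monic hm (by omega), hcast, AddChar.map_add_eq_mul, one_mul, hψ1,
        mul_neg_one]

end EvenCharacteristic

/-- There are uncountably many completely multiplicative functions
`f : 𝓜 → {−1,+1}` with finite long sum discrepancy `𝒟_f`. (Functions on `𝓜`
are encoded as functions on `𝔽_q[t]` vanishing off the monic polynomials.) -/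
theorem uncountably_many_bounded_long_sum_discrepancy :
    ¬ Set.Countable {f : F[X] → ℂ |
        CompMultOnMonic f ∧
        (∀ G : F[X], G.Monic → f G = 1 ∨ f G = -1) ∧
        (∀ G : F[X], ¬ G.Monic → f G = 0) ∧
        ∃ C : ℝ, ∀ N : ℕ, 1 ≤ N → ‖longSum f N‖ ≤ C} := by
  by_cases hF : ringChar F = 2
  · have : CharP F 2 := ringChar.of_eq hF
    exact not_countable_of_char_two
  · exact not_countable_of_odd_char hF

end FFEDP

end
end

section
/- Let m ≥ 1 be an integer, let w_1, …, w_m be complex numbers of modulus 1, and let ζ_1, …, ζ_m be complex numbers of modulus 1 with ζ_j ≠ 1 for all j. Then there exist positive integers k_1, …, k_m such that |Σ_{j=1}^m ζ_j^{k_j} w_j| ≥ m/7. -/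
open Polynomial Complex Filter
open scoped ENNReal ComplexConjugate

noncomputable section

namespace FFEDP

variable {F : Type} [Field F] [Fintype F] [DecidableEq F]

/-- Squaring repeatedly moves any `z ≠ 1` away from `1`. -/
lemma exists_pow_sub_one_norm_ge {z : ℂ} (hz : z ≠ 1) : ∃ k : ℕ, 4 / 7 ≤ ‖z ^ k - 1‖ := by
  by_contra! h
  have growth : ∀ n : ℕ, (10 / 7 : ℝ) ^ n * ‖z - 1‖ ≤ ‖z ^ 2 ^ n - 1‖ := by
    intro n
    induction n with
    | zero => simp
    | succ n ih =>
      set y := z ^ 2 ^ n with hy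
      have hfac : z ^ 2 ^ (n + 1) - 1 = (y + 1) * (y - 1) := by
        rw [hy, pow_succ 2 n, pow_mul]; ring
      have hlow : (10 / 7 : ℝ) ≤ ‖y + 1‖ := by
        have htri := norm_sub_le (y + 1) (y - 1)
        rw [show y + 1 - (y - 1) = 2 by ring, Complex.norm_ofNat] at htri
        linarith [h (2 ^ n)]
      rw [hfac, norm_mul, pow_succ', mul_assoc]
      exact mul_le_mul hlow ih (by positivity) (norm_nonneg _)
  have hpos : 0 < ‖z - 1‖ := norm_pos_iff.mpr (sub_ne_zero.mpr hz)
  obtain ⟨n, hn⟩ := pow_unbounded_of_one_lt (1 / ‖z - 1‖) (by norm_num : (1 : ℝ) < 10 / 7)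
  rw [div_lt_iff₀ hpos] at hn
  linarith [growth n, h (2 ^ n)]

/-- Choosing one of two points for each index, the sum can be made at least a quarter of the
total distance between the pairs. -/
lemma exists_choice_sum_norm_ge {ι : Type*} [Fintype ι] (p q : ι → ℂ) :
    ∃ s : ι → Bool,
      ∑ j, ‖p j - q j‖ ≤ 4 * ‖∑ j, if s j then p j else q j‖ := by
  by_contra! h
  have bound : ∀ c : ℂ, ‖c‖ = 1 →
      4 * ∑ j, max (c * p j).re (c * q j).re < ∑ j, ‖p j - q j‖ := by
    intro c hc
    refine lt_of_le_of_lt ?_ (h fun j => decide ((c * q j).re ≤ (c * p j).re))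
    gcongr
    rw [← one_mul ‖_‖, ← hc, ← norm_mul]
    refine le_trans (le_of_eq ?_) (Complex.re_le_norm _)
    rw [Finset.mul_sum, Complex.re_sum]
    refine Finset.sum_congr rfl fun j _ => ?_
    by_cases hj : (c * q j).re ≤ (c * p j).re
    · rw [max_eq_left hj]; simp only [hj, decide_true, if_true]
    · rw [max_eq_right (not_le.mp hj).le]; simp only [hj, decide_false, Bool.false_eq_true, if_false]
  have total : ∑ j, ‖p j - q j‖ ≤
      ∑ j, max (1 * p j).re (1 * q j).re + ∑ j, max (-1 * p j).re (-1 * q j).re +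
        ∑ j, max (I * p j).re (I * q j).re + ∑ j, max (-I * p j).re (-I * q j).re := by
    simp only [← Finset.sum_add_distrib]
    refine Finset.sum_le_sum fun j _ => ?_
    refine (Complex.norm_le_abs_re_add_abs_im _).trans (le_of_eq ?_)
    simp only [one_mul, neg_mul, neg_re, I_mul_re, neg_neg, sub_re, sub_im, max_neg_neg]
    linarith [max_sub_min_eq_abs' (p j).re (q j).re, max_sub_min_eq_abs' (p j).im (q j).im]
  linarith [bound 1 (by simp), bound (-1) (by simp), bound I (by simp), bound (-I) (by simp)]

/-- given unimodular `w₁,…,w_m` and unimodular `ζ₁,…,ζ_m` all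
different from `1`, there are positive integers `k₁,…,k_m` with
`|∑ ζ_j^{k_j} w_j| ≥ m/7`. -/
theorem exists_rotation (m : ℕ) (hm : 1 ≤ m) (w ζ : Fin m → ℂ)
    (hw : ∀ j, ‖w j‖ = 1) (hζ : ∀ j, ‖ζ j‖ = 1) (hζ1 : ∀ j, ζ j ≠ 1) :
    ∃ k : Fin m → ℕ, (∀ j, 1 ≤ k j) ∧
      (m : ℝ) / 7 ≤ ‖∑ j : Fin m, ζ j ^ k j * w j‖ := by
  choose e he using fun j => exists_pow_sub_one_norm_ge (hζ1 j)
  obtain ⟨s, hs⟩ := exists_choice_sum_norm_ge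
    (fun j => ζ j ^ (e j + 1) * w j) (fun j => ζ j ^ 1 * w j)
  refine ⟨fun j => if s j then e j + 1 else 1, fun j => by dsimp only; split_ifs <;> omega, ?_⟩
  have hsum : ∑ j, ζ j ^ (if s j then e j + 1 else 1) * w j =
      ∑ j, if s j then ζ j ^ (e j + 1) * w j else ζ j ^ 1 * w j :=
    Finset.sum_congr rfl fun j _ => by split_ifs <;> rfl
  have hdist : (m : ℝ) * (4 / 7) ≤ ∑ j, ‖ζ j ^ (e j + 1) * w j - ζ j ^ 1 * w j‖ := by
    have hcard := Finset.card_nsmul_le_sum Finset.univ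
      (fun j => ‖ζ j ^ (e j + 1) * w j - ζ j ^ 1 * w j‖) (4 / 7) fun j _ => by
        rw [show ζ j ^ (e j + 1) * w j - ζ j ^ 1 * w j = (ζ j ^ e j - 1) * (ζ j * w j) by ring,
          norm_mul, norm_mul, hζ, hw, mul_one, mul_one]
        exact he j
    simpa using hcard
  rw [hsum]
  linarith

end FFEDP

end
end

section
/- Let f : 𝓜 → S^1 be completely multiplicative, and suppose there exist θ ∈ [0,1], a short interval character ξ of length ν ≥ 0, and a non-principal Dirichlet character χ modulo P^r (with P a monic irreducible and r ≥ 1) such that f(P') = χ(P')ξ(P')e_θ(P') for all monic irreducibles P' ≠ P. Then for any H ≥ 1: Σ_{M ∈ 𝓜, deg M < H} f(M) = Σ_{M' ∈ 𝓜, deg M' < ν + r·deg P} χ(M')ξ(M')e_θ(M') · Σ_{0 ≤ k < (H − deg M')/deg P} f(P)^k. -/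
open Polynomial Complex Filter
open scoped ENNReal ComplexConjugate

noncomputable section

namespace FFEDP

variable {F : Type} [Field F] [Fintype F] [DecidableEq F]

section

variable {K : Type} [Field K]

namespace IsDirichletCharacter

variable {Q : K[X]} {χ : K[X] → ℂ}

theorem map_one (hχ : IsDirichletCharacter Q χ) : χ 1 = 1 := by
  obtain ⟨M, hM⟩ := hχ.exists_ne_zero
  have h := hχ.map_mul M 1
  rw [mul_one] at h
  exact mul_left_cancel₀ hM (by rw [← h, mul_one])

theorem map_add_C_mul (hχ : IsDirichletCharacter Q χ) (c : K) (M : K[X]) :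
    χ (M + C c * Q) = χ M := by
  rcases eq_or_ne c 0 with rfl | hc
  · simp
  have key : ∀ N : K[X], C c * (C c⁻¹ * N) = N := fun N ↦ by
    rw [← mul_assoc, ← C_mul, mul_inv_cancel₀ hc, C_1, one_mul]
  calc χ (M + C c * Q) = χ (C c * (C c⁻¹ * M + Q)) := by rw [mul_add, key]
    _ = χ M := by rw [hχ.map_mul, hχ.periodic, ← hχ.map_mul, key]

/-- Periodicity under `M ↦ M + Q` upgrades to dependence on the residue class only, as soon as
`Q` has a non-root in the base field. -/
theorem map_modByMonic (hχ : IsDirichletCharacter Q χ) (hQ : Q.Monic)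
    {a : K} (ha : Q.eval a ≠ 0) (M : K[X]) : χ (M %ₘ Q) = χ M := by
  induction hn : M.natDegree using Nat.strong_induction_on generalizing M with
  | _ n ih =>
  subst hn
  rcases lt_trichotomy M.natDegree Q.natDegree with hlt | heq | hgt
  · rw [(modByMonic_eq_self_iff hQ).2 (degree_lt_degree hlt)]
  · have hQ' : (M /ₘ Q).natDegree = 0 := by rw [natDegree_divByMonic _ hQ, heq, Nat.sub_self]
    obtain ⟨c, hc⟩ := natDegree_eq_zero.1 hQ'
    conv_rhs => rw [← modByMonic_add_div M Q, ← hc, mul_comm, hχ.map_add_C_mul]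
  · have hroot : (M + C (-(M.eval a / Q.eval a)) * Q).IsRoot a := by
      simp [ha]
    obtain ⟨M₁, hM₁⟩ := dvd_iff_isRoot.2 hroot
    have hdeg : (M + C (-(M.eval a / Q.eval a)) * Q).natDegree = M.natDegree :=
      natDegree_add_eq_left_of_natDegree_lt ((natDegree_C_mul_le _ _).trans_lt hgt)
    have hM₁0 : M₁ ≠ 0 := by
      rintro rfl
      rw [hM₁, mul_zero, natDegree_zero] at hdeg
      omega
    have hdeg₁ : M.natDegree = 1 + M₁.natDegree := by
      rw [← hdeg, hM₁, natDegree_mul (X_sub_C_ne_zero a) hM₁0, natDegree_X_sub_C]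
    have hdeg₂ : ((X - C a) * (M₁ %ₘ Q)).natDegree < M.natDegree := by
      have h₁ := natDegree_mul_le (p := X - C a) (q := M₁ %ₘ Q)
      rw [natDegree_X_sub_C] at h₁
      rcases eq_or_ne Q 1 with rfl | hQ1
      · rw [modByMonic_one, mul_zero, natDegree_zero]
        omega
      · have h₂ := natDegree_modByMonic_lt M₁ hQ hQ1
        omega
    have hres : ((X - C a) * (M₁ %ₘ Q)) %ₘ Q = M %ₘ Q := by
      apply modByMonic_eq_of_dvd_sub hQ
      refine ⟨C (-(M.eval a / Q.eval a)) - (X - C a) * (M₁ /ₘ Q), ?_⟩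
      have h := modByMonic_add_div M₁ Q
      linear_combination (X - C a) * h - hM₁
    calc χ (M %ₘ Q) = χ ((X - C a) * (M₁ %ₘ Q)) := by rw [← hres, ih _ hdeg₂ _ rfl]
      _ = χ ((X - C a) * M₁) := by rw [hχ.map_mul, hχ.map_mul, ih _ (by omega) _ rfl]
      _ = χ M := by rw [← hM₁, hχ.map_add_C_mul]

end IsDirichletCharacter

theorem IsShortIntervalCharacterOfLength.map_one {ν : ℕ} {ξ : K[X] → ℂ}
    (hξ : IsShortIntervalCharacterOfLength ν ξ) : ξ 1 = 1 := by
  obtain ⟨hmul, ⟨A, hA, hA0⟩, -⟩ := hξ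
  have h := hmul A 1 hA monic_one
  rw [mul_one] at h
  exact mul_left_cancel₀ hA0 (by rw [← h, mul_one])

theorem eTheta_one (θ : ℝ) : eTheta θ (1 : K[X]) = 1 := by
  simp [eTheta]

theorem eTheta_mul (θ : ℝ) {A B : K[X]} (hA : A ≠ 0) (hB : B ≠ 0) :
    eTheta θ (A * B) = eTheta θ A * eTheta θ B := by
  rw [eTheta, eTheta, eTheta, ← Complex.exp_add, natDegree_mul hA hB]
  push_cast
  ring_nf

theorem exists_eval_ne_zero_of_irreducible {P : K[X]} (hP : P.Monic) (hirr : Irreducible P) :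
    ∃ a : K, P.eval a ≠ 0 := by
  by_contra! h
  have key : ∀ a : K, X - C a = P := fun a ↦
    eq_of_monic_of_associated (monic_X_sub_C a) hP <|
      (irreducible_X_sub_C a).associated_of_dvd hirr (dvd_iff_isRoot.2 (h a))
  have h01 := (key 0).trans (key 1).symm
  simpa using congrArg (eval 0) h01

theorem finite_monic_natDegree_lt [Fintype K] (N : ℕ) :
    {G : K[X] | G.Monic ∧ G.natDegree < N}.Finite := by
  have : Finite (degreeLT K N) := Finite.of_equiv _ (degreeLTEquiv K N).toEquiv.symm
  refine (Set.toFinite (degreeLT K N : Set K[X])).subset fun G hG ↦ ?_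
  rw [SetLike.mem_coe, mem_degreeLT, degree_eq_natDegree hG.1.ne_zero]
  exact_mod_cast hG.2

/-- The finset of monic polynomials of degree less than `N`. -/
def monicsLt (K : Type) [Field K] [Fintype K] (N : ℕ) : Finset K[X] :=
  (finite_monic_natDegree_lt (K := K) N).toFinset

theorem mem_monicsLt [Fintype K] {N : ℕ} {G : K[X]} :
    G ∈ monicsLt K N ↔ G.Monic ∧ G.natDegree < N := by
  simp [monicsLt]

/-- Multiply the residue of `M` modulo `Q` by `A`, keeping the quotient. -/
def twistResidue (Q A M : K[X]) : K[X] :=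
  (A * M) %ₘ Q + Q * (M /ₘ Q)

section twistResidue

variable {Q A : K[X]}

theorem degree_twistResidue_sub_lt (hQ : Q.Monic) (M : K[X]) :
    (twistResidue Q A M - M).degree < Q.degree := by
  have h : twistResidue Q A M - M = (A * M) %ₘ Q - M %ₘ Q := by
    rw [twistResidue]
    linear_combination modByMonic_add_div M Q
  rw [h]
  exact (degree_sub_le _ _).trans_lt
    (max_lt (degree_modByMonic_lt _ hQ) (degree_modByMonic_lt _ hQ))

theorem coeff_twistResidue (hQ : Q.Monic) (M : K[X]) {i : ℕ} (hi : Q.natDegree ≤ i) :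
    (twistResidue Q A M).coeff i = M.coeff i := by
  have h : (twistResidue Q A M - M).coeff i = 0 :=
    coeff_eq_zero_of_degree_lt <| (degree_twistResidue_sub_lt hQ M).trans_le <|
      degree_le_natDegree.trans (by exact_mod_cast hi)
  rwa [coeff_sub, sub_eq_zero] at h

theorem natDegree_twistResidue (hQ : Q.Monic) {M : K[X]} (hM : M.Monic)
    (h : Q.natDegree ≤ M.natDegree) : (twistResidue Q A M).natDegree = M.natDegree := by
  refine natDegree_eq_of_le_of_coeff_ne_zero (natDegree_le_iff_coeff_eq_zero.2 fun i hi ↦ ?_) ?_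
  · rw [coeff_twistResidue hQ M (by omega), coeff_eq_zero_of_natDegree_lt hi]
  · rw [coeff_twistResidue hQ M h, hM.coeff_natDegree]
    exact one_ne_zero

theorem monic_twistResidue (hQ : Q.Monic) {M : K[X]} (hM : M.Monic)
    (h : Q.natDegree ≤ M.natDegree) : (twistResidue Q A M).Monic := by
  rw [Monic, leadingCoeff, natDegree_twistResidue hQ hM h, coeff_twistResidue hQ M h,
    hM.coeff_natDegree]

theorem topCoeff_twistResidue (hQ : Q.Monic) {M : K[X]} (hM : M.Monic) {i : ℕ}
    (h : i + Q.natDegree ≤ M.natDegree) : topCoeff (twistResidue Q A M) i = topCoeff M i := by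
  rw [topCoeff, topCoeff, natDegree_twistResidue hQ hM (by omega), if_pos (by omega),
    if_pos (by omega), coeff_twistResidue hQ M (by omega)]

theorem twistResidue_injective (hQ : Q.Monic) (hA : IsCoprime A Q) :
    Function.Injective (twistResidue Q A) := by
  intro M N hMN
  have hM := div_modByMonic_unique (f := twistResidue Q A M) _ _ hQ
    ⟨rfl, degree_modByMonic_lt _ hQ⟩
  have hN := div_modByMonic_unique (f := twistResidue Q A N) _ _ hQ
    ⟨rfl, degree_modByMonic_lt _ hQ⟩
  rw [hMN] at hM
  have hdiv : M /ₘ Q = N /ₘ Q := hM.1.symm.trans hN.1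
  have hmod : (A * M) %ₘ Q = (A * N) %ₘ Q := hM.2.symm.trans hN.2
  have hdvd : Q ∣ A * (M - N) := by
    rw [mul_sub, ← modByMonic_eq_zero_iff_dvd hQ, sub_modByMonic, hmod, sub_self]
  have hMN' : M %ₘ Q = N %ₘ Q :=
    modByMonic_eq_of_dvd_sub hQ (hA.symm.dvd_of_dvd_mul_left hdvd)
  rw [← modByMonic_add_div M Q, ← modByMonic_add_div N Q, hdiv, hMN']

theorem IsDirichletCharacter.map_twistResidue {χ : K[X] → ℂ} (hχ : IsDirichletCharacter Q χ)
    (hQ : Q.Monic) {a : K} (ha : Q.eval a ≠ 0) (M : K[X]) :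
    χ (twistResidue Q A M) = χ A * χ M := by
  rw [← hχ.map_mul, ← hχ.map_modByMonic hQ ha, ← hχ.map_modByMonic hQ ha (A * M)]
  congr 1
  apply modByMonic_eq_of_dvd_sub hQ
  refine ⟨M /ₘ Q - (A * M) /ₘ Q, ?_⟩
  rw [twistResidue]
  linear_combination modByMonic_add_div (A * M) Q

end twistResidue

/-- A non-principal Dirichlet character twisted by short interval and Archimedean characters sums
to zero over the monic polynomials of large degree. -/
theorem sum_twisted_character_eq_zero [Fintype K] {Q : K[X]} {χ ξ : K[X] → ℂ} {ν : ℕ} (θ : ℝ)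
    (hQ : Q.Monic) {a : K} (ha : Q.eval a ≠ 0) (hχ : IsDirichletCharacter Q χ)
    (hnp : ¬ IsPrincipalDirichletCharacter Q χ)
    (hξ : IsShortIntervalCharacterOfLength ν ξ) (H : ℕ) :
    ∑ M ∈ monicsLt K H with ν + Q.natDegree ≤ M.natDegree, χ M * ξ M * eTheta θ M = 0 := by
  obtain ⟨A, hA, hA1⟩ : ∃ A, IsCoprime A Q ∧ χ A ≠ 1 := by
    by_contra! h
    exact hnp ⟨hχ, h⟩
  set s := (monicsLt K H).filter fun M ↦ ν + Q.natDegree ≤ M.natDegree with hs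
  have hmem : ∀ M ∈ s, M.Monic ∧ M.natDegree < H ∧ ν + Q.natDegree ≤ M.natDegree := by
    intro M hM
    simpa [hs, mem_monicsLt, and_assoc] using hM
  have hmaps : ∀ M ∈ s, twistResidue Q A M ∈ s := by
    intro M hM
    obtain ⟨h₁, h₂, h₃⟩ := hmem M hM
    have hdeg := natDegree_twistResidue (A := A) hQ h₁ (by omega)
    simp only [hs, Finset.mem_filter, mem_monicsLt, hdeg]
    exact ⟨⟨monic_twistResidue hQ h₁ (by omega), h₂⟩, h₃⟩
  have hinj := twistResidue_injective hQ hA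
  have hsurj := Finset.surjOn_of_injOn_of_card_le (twistResidue Q A) hmaps hinj.injOn le_rfl
  have hterm : ∀ M ∈ s, χ (twistResidue Q A M) * ξ (twistResidue Q A M) *
      eTheta θ (twistResidue Q A M) = χ A * (χ M * ξ M * eTheta θ M) := by
    intro M hM
    obtain ⟨h₁, h₂, h₃⟩ := hmem M hM
    rw [hχ.map_twistResidue hQ ha, eTheta, eTheta,
      natDegree_twistResidue hQ h₁ (by omega),
      hξ.2.2 _ M (monic_twistResidue hQ h₁ (by omega)) h₁ fun i hi ↦
        topCoeff_twistResidue hQ h₁ (by omega)]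
    ring
  have hsum : χ A * ∑ M ∈ s, χ M * ξ M * eTheta θ M = ∑ M ∈ s, χ M * ξ M * eTheta θ M := by
    rw [Finset.mul_sum]
    exact Finset.sum_nbij (twistResidue Q A) hmaps hinj.injOn hsurj
      fun M hM ↦ (hterm M hM).symm
  have h0 : (χ A - 1) * ∑ M ∈ s, χ M * ξ M * eTheta θ M = 0 := by
    rw [sub_mul, hsum, one_mul, sub_self]
  exact (mul_eq_zero.1 h0).resolve_left (sub_ne_zero.2 hA1)

theorem eq_twisted_character_of_not_dvd {f χ ξ : K[X] → ℂ} {P Q : K[X]} {ν : ℕ} {θ : ℝ}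
    (hf : CompMultOnMonic f) (hχ : IsDirichletCharacter Q χ)
    (hξ : IsShortIntervalCharacterOfLength ν ξ)
    (hagree : ∀ P' : K[X], P'.Monic → Irreducible P' → P' ≠ P →
      f P' = χ P' * ξ P' * eTheta θ P')
    {M : K[X]} (hM : M.Monic) (hPM : ¬ P ∣ M) : f M = χ M * ξ M * eTheta θ M := by
  induction hn : M.natDegree using Nat.strong_induction_on generalizing M with
  | _ n ih =>
  subst hn
  by_cases hu : IsUnit M
  · rw [hM.isUnit_iff.1 hu, hf.1, hχ.map_one, hξ.map_one, eTheta_one, one_mul, one_mul]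
  obtain ⟨R, hR, hRirr, N, rfl⟩ := exists_monic_irreducible_factor M hu
  have hN : N.Monic := hR.of_mul_monic_left hM
  have hRP : R ≠ P := by
    rintro rfl
    exact hPM (dvd_mul_right _ _)
  have hdeg : N.natDegree < (R * N).natDegree := by
    have := hRirr.natDegree_pos
    rw [hR.natDegree_mul hN]
    omega
  rw [hf.2 R N hR hN, hχ.map_mul, hξ.1 R N hR hN, eTheta_mul θ hR.ne_zero hN.ne_zero,
    hagree R hR hRirr hRP, ih _ hdeg hN (fun h ↦ hPM (h.mul_left R)) rfl]
  ring

/-- Splitting off the constant term of a truncated geometric sum. -/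
theorem truncated_geom_sum_eq (c : ℂ) {d : ℕ} (hd : 0 < d) (H n : ℕ) :
    ∑ k ∈ Finset.range H with k * d + n < H, c ^ k =
      (if n < H then 1 else 0) +
        c * ∑ k ∈ Finset.range (H - d) with k * d + n < H - d, c ^ k := by
  rcases H with _ | H
  · simp
  have hset : (Finset.range (H + 1 - d)).filter (fun k ↦ k * d + n < H + 1 - d) =
      (Finset.range H).filter fun k ↦ (k + 1) * d + n < H + 1 := by
    ext k
    simp only [Finset.mem_filter, Finset.mem_range, add_mul, one_mul]
    have : k ≤ k * d := Nat.le_mul_of_pos_right k hd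
    omega
  rw [hset, Finset.sum_filter, Finset.sum_filter, Finset.sum_range_succ', Finset.mul_sum, add_comm]
  congr 1
  · simp
  · refine Finset.sum_congr rfl fun k _ ↦ ?_
    rw [mul_ite, mul_zero, pow_succ']

open Classical in
theorem sum_monicsLt_dvd [Fintype K] {f : K[X] → ℂ} (hf : CompMultOnMonic f) {P : K[X]} (hP : P.Monic)
    (H : ℕ) :
    ∑ M ∈ monicsLt K H with P ∣ M, f M = f P * ∑ M ∈ monicsLt K (H - P.natDegree), f M := by
  rw [Finset.mul_sum]
  symm
  refine Finset.sum_nbij (P * ·) ?_ (mul_right_injective₀ hP.ne_zero).injOn ?_ ?_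
  · intro M hM
    obtain ⟨h₁, h₂⟩ := mem_monicsLt.1 hM
    simp only [Finset.mem_filter, mem_monicsLt, hP.natDegree_mul h₁]
    exact ⟨⟨hP.mul h₁, by omega⟩, dvd_mul_right _ _⟩
  · intro M hM
    obtain ⟨hM, N, rfl⟩ := Finset.mem_filter.1 hM
    obtain ⟨h₁, h₂⟩ := mem_monicsLt.1 hM
    have hN := hP.of_mul_monic_left h₁
    rw [hP.natDegree_mul hN] at h₂
    exact ⟨N, mem_monicsLt.2 ⟨hN, by omega⟩, rfl⟩
  · intro M hM
    exact (hf.2 P M hP (mem_monicsLt.1 hM).1).symm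

/-- If `f` agrees with `g` away from multiples of `P`, where `g` vanishes, and `g` has no
contribution from degrees at least `N`, then the partial sums of `f` are determined by `g` on
degrees less than `N` together with `f P`. -/
theorem sum_monicsLt_eq [Fintype K] {f g : K[X] → ℂ} (hf : CompMultOnMonic f) {P : K[X]} (hP : P.Monic)
    (hd : 0 < P.natDegree) (hfg : ∀ M : K[X], M.Monic → ¬ P ∣ M → f M = g M)
    (hg : ∀ M : K[X], P ∣ M → g M = 0) {N : ℕ}
    (hvanish : ∀ H, ∑ M ∈ monicsLt K H with N ≤ M.natDegree, g M = 0) (H : ℕ) :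
    ∑ M ∈ monicsLt K H, f M = ∑ M ∈ monicsLt K N, g M *
      ∑ k ∈ Finset.range H with k * P.natDegree + M.natDegree < H, f P ^ k := by
  classical
  induction H using Nat.strong_induction_on with
  | _ H ih =>
  rcases Nat.eq_zero_or_pos H with rfl | hH
  · simp [monicsLt]
  have hsplit := Finset.sum_filter_add_sum_filter_not (monicsLt K H) (P ∣ ·) f
  have hcoprime : ∑ M ∈ monicsLt K H with ¬ P ∣ M, f M = ∑ M ∈ monicsLt K H, g M := by
    rw [Finset.sum_filter]
    refine Finset.sum_congr rfl fun M hM ↦ ?_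
    split_ifs with h
    · exact (hg M h).symm
    · exact hfg M (mem_monicsLt.1 hM).1 h
  have htrunc : ∑ M ∈ monicsLt K H, g M =
      ∑ M ∈ monicsLt K N, g M * (if M.natDegree < H then 1 else 0) := by
    have hsets : (monicsLt K H).filter (fun M ↦ ¬ N ≤ M.natDegree) =
        (monicsLt K N).filter fun M ↦ M.natDegree < H := by
      ext M
      simp only [Finset.mem_filter, mem_monicsLt, not_le]
      tauto
    rw [← Finset.sum_filter_add_sum_filter_not (monicsLt K H) (N ≤ ·.natDegree) g, hvanish,
      zero_add, hsets, Finset.sum_filter]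
    simp only [mul_ite, mul_one, mul_zero]
  rw [← hsplit, sum_monicsLt_dvd hf hP, ih _ (by omega), hcoprime, htrunc, Finset.mul_sum,
    ← Finset.sum_add_distrib]
  refine Finset.sum_congr rfl fun M _ ↦ ?_
  rw [truncated_geom_sum_eq (f P) hd H]
  ring

theorem finsum_mem_monic_natDegree_lt [Fintype K] (g : K[X] → ℂ) (N : ℕ) :
    ∑ᶠ M ∈ {M : K[X] | M.Monic ∧ M.natDegree < N}, g M = ∑ M ∈ monicsLt K N, g M :=
  finsum_mem_eq_finite_toFinset_sum g (finite_monic_natDegree_lt N)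

end

/-- explicit evaluation of `∑_{M ∈ 𝓜, deg M < H} f(M)` for a
twisted modified character of prime power modulus `P^r`. -/
theorem modified_character_partial_sum_formula
    (f χ ξ : F[X] → ℂ) (P : F[X]) (r ν : ℕ) (θ : ℝ)
    (hf : CompMultOnMonic f) (hu : UnimodularOnMonic f)
    (hP : P.Monic) (hirr : Irreducible P) (hr : 1 ≤ r)
    (hχ : IsDirichletCharacter (P ^ r) χ)
    (hnp : ¬ IsPrincipalDirichletCharacter (P ^ r) χ)
    (hξ : IsShortIntervalCharacterOfLength ν ξ)
    (hθ : θ ∈ Set.Icc (0 : ℝ) 1)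
    (hagree : ∀ P' : F[X], P'.Monic → Irreducible P' → P' ≠ P →
      f P' = χ P' * ξ P' * eTheta θ P') :
    ∀ H : ℕ, 1 ≤ H →
      longSumLt f H =
        ∑ᶠ M' ∈ {M' : F[X] | M'.Monic ∧ M'.natDegree < ν + r * P.natDegree},
          χ M' * ξ M' * eTheta θ M' *
            ∑ᶠ k ∈ {k : ℕ | (k : ℤ) * P.natDegree < (H : ℤ) - M'.natDegree},
              f P ^ k := by

  intro H _
  have hQ : (P ^ r).Monic := hP.pow r
  obtain ⟨a, ha⟩ := exists_eval_ne_zero_of_irreducible hP hirr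
  have haQ : (P ^ r).eval a ≠ 0 := by
    rw [eval_pow]
    exact pow_ne_zero r ha
  have hd : 0 < P.natDegree := hirr.natDegree_pos
  have hg : ∀ M : F[X], P ∣ M → χ M * ξ M * eTheta θ M = 0 := by
    intro M hM
    rw [hχ.eq_zero_of_not_coprime M, zero_mul, zero_mul]
    exact fun h ↦ hirr.not_isUnit (h.isUnit_of_dvd' hM (dvd_pow_self P (by omega)))
  rw [longSumLt, finsum_mem_monic_natDegree_lt, finsum_mem_monic_natDegree_lt,
    sum_monicsLt_eq (g := fun M ↦ χ M * ξ M * eTheta θ M) hf hP hd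
      (fun M hM hPM ↦ eq_twisted_character_of_not_dvd hf hχ hξ hagree hM hPM) hg
      (fun H ↦ hP.natDegree_pow r ▸ sum_twisted_character_eq_zero θ hQ haQ hχ hnp hξ H)]
  refine Finset.sum_congr rfl fun M _ ↦ ?_
  have hset : {k : ℕ | (k : ℤ) * P.natDegree < (H : ℤ) - M.natDegree} =
      ((Finset.range H).filter fun k ↦ k * P.natDegree + M.natDegree < H : Finset ℕ) := by
    ext k
    have hk : k ≤ k * P.natDegree := Nat.le_mul_of_pos_right k hd
    simp only [Finset.coe_filter, Finset.mem_range, Set.mem_ofPred_eq]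
    zify at hk ⊢
    omega
  rw [hset, finsum_mem_coe_finset]

end FFEDP

end
end
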